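/- Let p ≥ 5 be a prime and let D be a nontrivial regular (8p^3, 4p^2+2p−2, 2p−2, 2p+2)-partial difference set in an Abelian group G of order 8p^3. Then for every subgroup H of G of order 8p^2, either |D ∩ H| = 2p+2 or |D ∩ H| = 6p−2. -/

import Mathlib

variable {G : Type*} [CommGroup G] [DecidableEq G] [Fintype G]

/-- The number of representations of `g` as `d₁ * d₂⁻¹` with `d₁, d₂ ∈ D`, `d₁ ≠ d₂`. -/
def pdsReps (D : Finset G) (g : G) : ℕ :=
  ((D ×ˢ D).filter (fun x => x.1 ≠ x.2 ∧ x.1 * x.2⁻¹ = g)).card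

/-- `D` is a `(v,k,λ,μ)`-partial difference set in `G`. -/
def IsPDS (D : Finset G) (v k l m : ℕ) : Prop :=
  Fintype.card G = v ∧ D.card = k ∧
  (∀ g : G, g ≠ 1 → g ∈ D → pdsReps D g = l) ∧
  (∀ g : G, g ≠ 1 → g ∉ D → pdsReps D g = m)

/-- `D` is regular: closed under inverses and not containing the identity. -/
def IsRegularPDS (D : Finset G) : Prop :=
  (∀ d ∈ D, d⁻¹ ∈ D) ∧ (1 : G) ∉ D

/-- A regular PDS is trivial if `D ∪ {e}` or `G \ D` is a subgroup. -/
def IsTrivialPDS (D : Finset G) : Prop :=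
  (∃ H : Subgroup G, (H : Set G) = ↑D ∪ {1}) ∨
  (∃ H : Subgroup G, (H : Set G) = (↑D : Set G)ᶜ)

open Polynomial in
/-- The only integral linear relations among the powers `1, ζ, …, ζ ^ (p - 1)` of a primitive
`p`-th root of unity are the multiples of the relation `∑ ζ ^ i = 0`. -/
theorem IsPrimitiveRoot.exists_coeff_eq_of_sum_eq_zero {p : ℕ} (hp : p.Prime) {ζ : ℂ}
    (hζ : IsPrimitiveRoot ζ p) (a : ℕ → ℤ)
    (h : ∑ i ∈ Finset.range p, (a i : ℂ) * ζ ^ i = 0) : ∃ t : ℤ, ∀ i < p, a i = t := by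
  have : Fact p.Prime := ⟨hp⟩
  set F : ℤ[X] := ∑ i ∈ Finset.range p, C (a i) * X ^ i with hF
  have hcoeff : ∀ i < p, F.coeff i = a i := by
    intro i hi
    simp [hF, Polynomial.coeff_X_pow, hi]
  have hdvd : cyclotomic p ℤ ∣ F := by
    rw [cyclotomic_eq_minpoly hζ hp.pos]
    refine minpoly.isIntegrallyClosed_dvd (hζ.isIntegral hp.pos) ?_
    simpa [hF] using h
  obtain ⟨q, hq⟩ := hdvd
  have hdeg : F.natDegree ≤ p - 1 := by
    refine natDegree_sum_le_of_forall_le _ _ fun i hi => ?_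
    refine (natDegree_C_mul_X_pow_le _ _).trans ?_
    have := Finset.mem_range.1 hi
    omega
  have hq0 : q.natDegree = 0 := by
    by_cases hq' : q = 0
    · simp [hq']
    · have := natDegree_mul (cyclotomic_ne_zero p ℤ) hq'
      rw [← hq, natDegree_cyclotomic, Nat.totient_prime hp] at this
      omega
  obtain ⟨t, rfl⟩ := natDegree_eq_zero.1 hq0
  refine ⟨t, fun i hi => ?_⟩
  rw [← hcoeff i hi, hq, coeff_mul_C, cyclotomic_prime]
  simp [Polynomial.coeff_X_pow, hi]

/-- Counting the representations `g = d₁ * d₂⁻¹` weighted by a character. -/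
theorem sum_pdsReps_mul_eq {G : Type*} [CommGroup G] [DecidableEq G] [Fintype G]
    {R : Type*} [CommRing R] (D : Finset G) (χ : G →* R) :
    (∑ d ∈ D, χ d) * ∑ d ∈ D, χ d⁻¹ =
      D.card + ∑ g ∈ Finset.univ.erase 1, (pdsReps D g : R) * χ g := by
  have hdiag : ∑ x ∈ (D ×ˢ D).filter (fun x => ¬ x.1 ≠ x.2), χ (x.1 * x.2⁻¹) = D.card := by
    have h1 : (D ×ˢ D).filter (fun x => ¬ x.1 ≠ x.2) = D.diag := by
      ext x
      simp only [Finset.mem_filter, Finset.mem_product, Finset.mem_diag]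
      grind
    rw [h1, Finset.sum_congr rfl (g := fun _ => (1 : R)), Finset.sum_const,
      Finset.diag_card, nsmul_one]
    intro x hx
    rw [(Finset.mem_diag.1 hx).2, mul_inv_cancel, map_one]
  have hoff : ∑ x ∈ (D ×ˢ D).filter (fun x => x.1 ≠ x.2), χ (x.1 * x.2⁻¹) =
      ∑ g ∈ Finset.univ.erase 1, (pdsReps D g : R) * χ g := by
    rw [← Finset.sum_fiberwise_of_maps_to (t := Finset.univ.erase (1 : G))
      (g := fun x => x.1 * x.2⁻¹)]
    · refine Finset.sum_congr rfl fun g _ => ?_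
      rw [Finset.filter_filter, Finset.sum_congr rfl (g := fun _ => χ g), Finset.sum_const,
        nsmul_eq_mul, pdsReps]
      intro x hx
      rw [(Finset.mem_filter.1 hx).2.2]
    · intro x hx
      simpa [mul_inv_eq_one] using (Finset.mem_filter.1 hx).2
  rw [Finset.sum_mul_sum, ← Finset.sum_product', ← hdiag, ← hoff, add_comm,
    Finset.sum_filter_add_sum_filter_not]
  simp only [map_mul]

/-- The quadratic equation satisfied by a nontrivial character sum over a regular partial
difference set. -/
theorem IsPDS.character_sum_sq {G : Type*} [CommGroup G] [DecidableEq G] [Fintype G]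
    {R : Type*} [CommRing R] [IsDomain R] {D : Finset G} {v k l m : ℕ} (hD : IsPDS D v k l m)
    (hreg : IsRegularPDS D) {χ : G →* R} (hχ : χ ≠ 1) :
    (∑ d ∈ D, χ d) ^ 2 = k - m + ((l : R) - m) * ∑ d ∈ D, χ d := by
  obtain ⟨-, hk, hl, hm⟩ := hD
  obtain ⟨hinv, hone⟩ := hreg
  have hsymm : ∑ d ∈ D, χ d⁻¹ = ∑ d ∈ D, χ d :=
    Finset.sum_nbij' (·⁻¹) (·⁻¹) hinv hinv (by simp) (by simp) (by simp)
  have hsum := sum_hom_units_eq_zero χ hχ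
  have hD' : ∑ g ∈ Finset.univ.erase 1, (if g ∈ D then χ g else 0) = ∑ d ∈ D, χ d := by
    rw [← Finset.sum_filter]
    congr 1
    ext g
    simp only [Finset.mem_filter, Finset.mem_erase, Finset.mem_univ, and_true]
    exact ⟨And.right, fun h => ⟨fun h1 => hone (h1 ▸ h), h⟩⟩
  have herase : ∑ g ∈ Finset.univ.erase (1 : G), χ g = -1 := by
    rw [← Finset.add_sum_erase _ _ (Finset.mem_univ (1 : G)), map_one] at hsum
    linear_combination hsum
  have hreps : ∑ g ∈ Finset.univ.erase 1, (pdsReps D g : R) * χ g =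
      ∑ g ∈ Finset.univ.erase 1,
        ((m : R) * χ g + ((l : R) - m) * if g ∈ D then χ g else 0) := by
    refine Finset.sum_congr rfl fun g hg => ?_
    have hg1 := Finset.ne_of_mem_erase hg
    by_cases hgD : g ∈ D
    · rw [hl g hg1 hgD, if_pos hgD]; ring
    · rw [hm g hg1 hgD, if_neg hgD]; ring
  have key := sum_pdsReps_mul_eq D χ
  rw [hsymm, hreps, Finset.sum_add_distrib, ← Finset.mul_sum, ← Finset.mul_sum, herase, hD',
    hk] at key
  linear_combination key

/-- A subgroup of prime index `p` is the kernel of a surjection onto `ZMod p`. -/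
theorem Subgroup.exists_hom_zmod_of_index_prime {G : Type*} [CommGroup G] {p : ℕ}
    (hp : p.Prime) (H : Subgroup G) (hH : H.index = p) :
    ∃ φ : G →* Multiplicative (ZMod p), Function.Surjective φ ∧ φ.ker = H := by
  have : Fact p.Prime := ⟨hp⟩
  let e : G ⧸ H ≃* Multiplicative (ZMod p) :=
    mulEquivOfPrimeCardEq (p := p) hH (by simp)
  refine ⟨e.toMonoidHom.comp (QuotientGroup.mk' H),
    e.surjective.comp (QuotientGroup.mk'_surjective H), ?_⟩
  ext g
  simp

/-- If a character sum over `D` attached to a subgroup `H` of prime index `p` is an integer `c`,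
then `D` is equidistributed over the nontrivial cosets of `H`. -/
theorem IsPrimitiveRoot.exists_card_eq_of_sum_eq_intCast {G : Type*} [CommGroup G] {p : ℕ}
    [NeZero p] (hp : p.Prime) {ζ : ℂ} (hζ : IsPrimitiveRoot ζ p) (D : Finset G)
    (φ : G →* Multiplicative (ZMod p)) {c : ℤ}
    (hc : ∑ d ∈ D, ζ ^ (φ d).toAdd.val = c) :
    ∃ t : ℤ, ((D.filter fun d => φ d = 1).card : ℤ) = c + t ∧ (D.card : ℤ) = c + p * t := by
  set n : ℕ → ℤ := fun i => (D.filter fun d => (φ d).toAdd.val = i).card with hn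
  have hmaps : ∀ d ∈ D, (φ d).toAdd.val ∈ Finset.range p :=
    fun d _ => Finset.mem_range.2 (ZMod.val_lt _)
  have hsum : ∑ i ∈ Finset.range p, (n i : ℂ) * ζ ^ i = c := by
    rw [← hc, ← Finset.sum_fiberwise_of_maps_to hmaps]
    refine Finset.sum_congr rfl fun i _ => ?_
    rw [Finset.sum_congr rfl (g := fun _ => ζ ^ i), Finset.sum_const, nsmul_eq_mul]
    · simp [hn]
    · intro d hd
      rw [(Finset.mem_filter.1 hd).2]
  have h0 : 0 ∈ Finset.range p := Finset.mem_range.2 hp.pos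
  have hone : (D.filter fun d => φ d = 1) = D.filter fun d => (φ d).toAdd.val = 0 := by
    refine Finset.filter_congr fun d _ => ?_
    rw [ZMod.val_eq_zero, toAdd_eq_zero]
  obtain ⟨t, ht⟩ := hζ.exists_coeff_eq_of_sum_eq_zero hp (fun i => n i - if i = 0 then c else 0) (by
    simp only [Int.cast_sub, sub_mul, Finset.sum_sub_distrib, hsum]
    rw [Finset.sum_eq_single_of_mem 0 h0 (fun i _ hi => by simp [hi])]
    simp)
  have hni : ∀ i ∈ Finset.range p, n i = t + if i = 0 then c else 0 := fun i hi => by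
    linear_combination ht i (Finset.mem_range.1 hi)
  refine ⟨t, ?_, ?_⟩
  · rw [hone]
    have := hni 0 h0
    simp only [if_true] at this
    linear_combination this
  · rw [Finset.card_eq_sum_card_fiberwise hmaps]
    push_cast
    rw [Finset.sum_congr rfl hni, Finset.sum_add_distrib, Finset.sum_ite_eq', if_pos h0]
    simp [add_comm]

/-- For a nontrivial regular `(8p^3, 4p^2+2p-2, 2p-2, 2p+2)`-PDS `D` in an
Abelian group `G`, every subgroup `H` of order `8p^2` meets `D` in either
`2p+2` or `6p-2` elements. -/
theorem pds_case1_subgroup_intersection (p : ℕ) (hp : p.Prime) (hp5 : 5 ≤ p)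
    {G : Type*} [CommGroup G] [DecidableEq G] [Fintype G]
    (D : Finset G)
    (hPDS : IsPDS D (8 * p ^ 3) (4 * p ^ 2 + 2 * p - 2) (2 * p - 2) (2 * p + 2))
    (hreg : IsRegularPDS D) (hnt : ¬ IsTrivialPDS D)
    (H : Subgroup G) (hH : Nat.card H = 8 * p ^ 2) :
    ((D : Set G) ∩ (H : Set G)).ncard = 2 * p + 2 ∨
      ((D : Set G) ∩ (H : Set G)).ncard = 6 * p - 2 := by
  have : NeZero p := ⟨hp.ne_zero⟩
  have : Fact (1 < p) := ⟨hp.one_lt⟩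
  have hindex : H.index = p := by
    have h := H.card_mul_index
    rw [hH, Nat.card_eq_fintype_card, hPDS.1, pow_succ p 2, ← mul_assoc] at h
    exact Nat.eq_of_mul_eq_mul_left (by positivity) h
  obtain ⟨φ, hφ, hker⟩ := H.exists_hom_zmod_of_index_prime hp hindex
  have hζ := Complex.isPrimitiveRoot_exp p hp.ne_zero
  set ζ := Complex.exp (2 * Real.pi * Complex.I / p)
  let χ : G →* ℂ := (AddChar.zmodChar p hζ.pow_eq_one).toMonoidHom.comp φ
  have hχ_apply : ∀ g, χ g = ζ ^ (φ g).toAdd.val := fun g => AddChar.zmodChar_apply hζ.pow_eq_one _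
  have hχ : χ ≠ 1 := by
    obtain ⟨g, hg⟩ := hφ (Multiplicative.ofAdd 1)
    intro h
    have h1 := hχ_apply g
    rw [h, hg, toAdd_ofAdd, ZMod.val_one, pow_one] at h1
    exact hζ.ne_one hp.one_lt h1.symm
  have hsq := hPDS.character_sum_sq hreg hχ
  rw [Nat.cast_sub (by nlinarith), Nat.cast_sub (by omega)] at hsq
  push_cast at hsq
  have hfactor : (∑ d ∈ D, χ d - (2 * p - 2)) * (∑ d ∈ D, χ d - (-2 * p - 2)) = 0 := by
    linear_combination hsq
  have hcard : ((D.card : ℕ) : ℤ) = 4 * p ^ 2 + 2 * p - 2 := by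
    rw [hPDS.2.1, Nat.cast_sub (by nlinarith)]
    push_cast
    ring
  have hinter : ((D : Set G) ∩ (H : Set G)).ncard = (D.filter fun d => φ d = 1).card := by
    rw [← Set.ncard_coe_finset]
    congr 1
    ext g
    simp [← hker, MonoidHom.mem_ker]
  have hp0 : (p : ℤ) ≠ 0 := by exact_mod_cast hp.ne_zero
  rw [hinter]
  simp only [hχ_apply] at hfactor
  rcases mul_eq_zero.1 hfactor with h | h
  · obtain ⟨t, ht, hk⟩ := hζ.exists_card_eq_of_sum_eq_intCast hp D φ (c := 2 * p - 2)
      (by push_cast; linear_combination h)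
    have : t = 4 * p := mul_left_cancel₀ hp0 (by linear_combination hcard - hk)
    right
    omega
  · obtain ⟨t, ht, hk⟩ := hζ.exists_card_eq_of_sum_eq_intCast hp D φ (c := -2 * p - 2)
      (by push_cast; linear_combination h)
    have : t = 4 * p + 4 := mul_left_cancel₀ hp0 (by linear_combination hcard - hk)
    left
    omega
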